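/- Let n ≥ 0, x ∈ Z(G), and ψ ∈ C^n(G, k x̄). Then ν^n_{G,x,α}(τψ) = τ·(ν^n_{G,x,α}(ψ)) for every τ ∈ Σ_{n+1}, where Σ_{n+1} acts on C^n(G, k x̄) by Staic's action and on C^n(k_αG,k_αG) by the symmetric Hochschild action; equivalently, ν^n_{G,x,α}(σ_i ψ) = σ_i(ν^n_{G,x,α}(ψ)) for each transposition σ_i = (i,i+1), 1 ≤ i ≤ n. -/

import Mathlib

/- Common setup: twisted group algebras modelled on their canonical basis.
An element of the twisted group algebra `k_αG` is modelled as a function `G → k`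
(its coordinates in the basis `{ḡ : g ∈ G}`), and a Hochschild `n`-cochain
`Hom_k((k_αG)^{⊗n}, M)` is modelled by its values on basis tensors, i.e. as a
function `(Fin n → G) → M`.  Similarly a group cochain `C^n(H, A)` is a function
`(Fin n → H) → A`; the one-dimensional module `k x̄` is modelled as `k` with the
action of `h` given by multiplication by the character `χ(h) = α(h,x)·α(x,h)⁻¹`. -/

namespace TwistedSym

section Defs

variable {k : Type*} [CommRing k] {G : Type*} [Group G] [DecidableEq G]
variable {M : Type*} [AddCommGroup M] [Module k M]
variable {H : Type*} [Group H]
variable {A : Type*} [AddCommGroup A] [DistribMulAction H A]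

/-- The 2-cocycle condition `α(x,yz)α(y,z) = α(xy,z)α(x,y)`. -/
def IsCocycle (α : G → G → kˣ) : Prop :=
  ∀ x y z : G, α x (y * z) * α y z = α (x * y) z * α x y

/-- Normalization `α(1,x) = α(x,1) = 1`. -/
def IsNormalized (α : G → G → kˣ) : Prop :=
  ∀ x : G, α 1 x = 1 ∧ α x 1 = 1

/-- `(L, R)` encode a `(k_αG, k_αG)`-bimodule structure on the `k`-module `M`:
`L g` is left multiplication by the basis element `ḡ` and `R g` is right
multiplication by `ḡ`. -/
def IsBimodule (α : G → G → kˣ) (L R : G → M →ₗ[k] M) : Prop :=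
  (∀ m : M, L 1 m = m) ∧ (∀ m : M, R 1 m = m) ∧
  (∀ (g h : G) (m : M), L g (L h m) = (α g h : k) • L (g * h) m) ∧
  (∀ (g h : G) (m : M), R h (R g m) = (α g h : k) • R (g * h) m) ∧
  (∀ (g h : G) (m : M), L g (R h m) = R h (L g m))

/-- The tuple of group elements appearing in the action of the transposition
`σ_{i0+1} = (i0+1, i0+2)` on `n`-cochains (0-indexed `i0 : Fin n`):
position `i0 - 1` gets `g_{i0-1}·g_{i0}`, position `i0` gets `g_{i0}⁻¹` and
position `i0 + 1` gets `g_{i0}·g_{i0+1}` (when these positions exist). -/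
def swapTuple {n : ℕ} (i0 : Fin n) (g : Fin n → H) : Fin n → H := fun j =>
  if (j : ℕ) + 1 = (i0 : ℕ) then g j * g i0
  else if j = i0 then (g i0)⁻¹
  else if (j : ℕ) = (i0 : ℕ) + 1 then g i0 * g j
  else g j

/-- The action of the transposition `σ_{i0+1} = (i0+1,i0+2) ∈ Σ_{n+1}` on Hochschild
`n`-cochains of the twisted group algebra `k_αG` with coefficients in the bimodule `M`.
All the `α`-scalars come from rewriting products and inverses of basis elements in
terms of basis elements: `ḡ·h̄ = α(g,h)·(gh)‾` and `ḡ⁻¹ = α(g,g⁻¹)⁻¹·(g⁻¹)‾`. -/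
def hSigma (α : G → G → kˣ) (L R : G → M →ₗ[k] M) {n : ℕ} (i0 : Fin n)
    (φ : (Fin n → G) → M) : (Fin n → G) → M := fun g =>
  -(((if 0 < (i0 : ℕ) then
        (α (g ⟨(i0 : ℕ) - 1, lt_of_le_of_lt (Nat.sub_le _ _) i0.isLt⟩) (g i0) : k) else 1) *
     (((α (g i0) (g i0)⁻¹)⁻¹ : kˣ) : k) *
     (if h : (i0 : ℕ) + 1 < n then (α (g i0) (g ⟨(i0 : ℕ) + 1, h⟩) : k) else 1)) •
    (if (i0 : ℕ) = 0 then
        L (g i0) (if (i0 : ℕ) + 1 = n then R (g i0) (φ (swapTuple i0 g)) else φ (swapTuple i0 g))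
      else (if (i0 : ℕ) + 1 = n then R (g i0) (φ (swapTuple i0 g)) else φ (swapTuple i0 g))))

/-- Staic's action of the transposition `σ_{i0+1} ∈ Σ_{n+1}` on group `n`-cochains
with values in an `H`-module `A`. -/
def gSigma {n : ℕ} (i0 : Fin n) (ψ : (Fin n → H) → A) : (Fin n → H) → A := fun h =>
  -(if (i0 : ℕ) = 0 then h i0 • ψ (swapTuple i0 h) else ψ (swapTuple i0 h))

/-- Staic's action of the transposition `σ_{i0+1} ∈ Σ_{n+1}` on group `n`-cochains
with values in the rank-one module `k` on which `H` acts through the character `χ`. -/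
def cSigma (χ : H → k) {n : ℕ} (i0 : Fin n) (ψ : (Fin n → H) → k) : (Fin n → H) → k := fun h =>
  -(if (i0 : ℕ) = 0 then χ (h i0) * ψ (swapTuple i0 h) else ψ (swapTuple i0 h))

/-- The `(n+1)`-tuple `g` with entries at positions `j, j+1` multiplied together. -/
def mergeAt {n : ℕ} (g : Fin (n + 1) → H) (j : Fin n) : Fin n → H := fun l =>
  if (l : ℕ) < (j : ℕ) then g (Fin.castSucc l)
  else if l = j then g (Fin.castSucc l) * g (Fin.succ l)
  else g (Fin.succ l)

/-- The Hochschild differential `δ^n` for the twisted group algebra `k_αG` with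
coefficients in the bimodule `M`, written on basis tensors (the scalar
`α(g_j, g_{j+1})` comes from `ḡ_j·ḡ_{j+1} = α(g_j,g_{j+1})·(g_jg_{j+1})‾`). -/
def hDiff (α : G → G → kˣ) (L R : G → M →ₗ[k] M) {n : ℕ}
    (φ : (Fin n → G) → M) : (Fin (n + 1) → G) → M := fun g =>
  L (g 0) (φ fun j => g j.succ)
    + ∑ j : Fin n, ((-1 : ℤ) ^ ((j : ℕ) + 1)) •
        ((α (g j.castSucc) (g j.succ) : k) • φ (mergeAt g j))
    + ((-1 : ℤ) ^ (n + 1)) • R (g (Fin.last n)) (φ fun j => g j.castSucc)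

/-- The group cohomology differential `∂^n` for cochains on `H` with values in the
`H`-module `A`. -/
def gDiff {n : ℕ} (ψ : (Fin n → H) → A) : (Fin (n + 1) → H) → A := fun h =>
  h 0 • ψ (fun j => h j.succ)
    + ∑ j : Fin n, ((-1 : ℤ) ^ ((j : ℕ) + 1)) • ψ (mergeAt h j)
    + ((-1 : ℤ) ^ (n + 1)) • ψ (fun j => h j.castSucc)

/-- The group cohomology differential `∂^n` for cochains on `H` with values in the
rank-one module `k` on which `H` acts through the character `χ`. -/
def cDiff (χ : H → k) {n : ℕ} (ψ : (Fin n → H) → k) : (Fin (n + 1) → H) → k := fun h =>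
  χ (h 0) * ψ (fun j => h j.succ)
    + ∑ j : Fin n, ((-1 : ℤ) ^ ((j : ℕ) + 1)) • ψ (mergeAt h j)
    + ((-1 : ℤ) ^ (n + 1)) • ψ (fun j => h j.castSucc)

/-- Left multiplication by the basis element `ḡ` on `k_αG` (modelled as `G → k`). -/
def Lmul (α : G → G → kˣ) (g : G) : (G → k) →ₗ[k] (G → k) where
  toFun a := fun y => (α g (g⁻¹ * y) : k) * a (g⁻¹ * y)
  map_add' a b := by funext y; simp [mul_add]
  map_smul' c a := by funext y; simp [smul_eq_mul]; ring

/-- Right multiplication by the basis element `ḡ` on `k_αG` (modelled as `G → k`). -/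
def Rmul (α : G → G → kˣ) (g : G) : (G → k) →ₗ[k] (G → k) where
  toFun a := fun y => (α (y * g⁻¹) g : k) * a (y * g⁻¹)
  map_add' a b := by funext y; simp [mul_add]
  map_smul' c a := by funext y; simp [smul_eq_mul]; ring

/-- Iterated right multiplication: `rmuls α [g₁,…,gₙ] v = v·ḡ₁·…·ḡₙ`. -/
def rmuls (α : G → G → kˣ) (l : List G) (v : G → k) : G → k :=
  l.foldl (fun w g => Rmul α g w) v

/-- Iterated right multiplication by inverses of basis elements:
`rinvs α [h₁,…,hₙ] v = v·h̄ₙ⁻¹·…·h̄₁⁻¹`, using `h̄⁻¹ = α(h,h⁻¹)⁻¹·(h⁻¹)‾`. -/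
def rinvs (α : G → G → kˣ) (l : List G) (v : G → k) : G → k :=
  l.foldr (fun h w => (((α h h⁻¹)⁻¹ : kˣ) : k) • Rmul α h⁻¹ w) v

/-- The character through which `h ∈ C_G(x)` acts on the module `k x̄`:
`χ(h) = α(h,x)·α(x,h)⁻¹`. -/
def chi (α : G → G → kˣ) (x : G) : G → k := fun h =>
  (α h x : k) * (((α x h)⁻¹ : kˣ) : k)

/-- The map `π^n_{G,x,α} : C^n(k_αG, k_αG) → C^n(C_G(x), k x̄)`: the value on
`(h₁,…,hₙ)` is the coefficient of the basis element `x̄` in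
`φ(h̄₁⊗…⊗h̄ₙ)·h̄ₙ⁻¹·…·h̄₁⁻¹` (identifying `k x̄` with `k`). -/
def piC (α : G → G → kˣ) (x : G) {n : ℕ} (φ : (Fin n → G) → (G → k)) :
    (Fin n → Subgroup.centralizer ({x} : Set G)) → k := fun h =>
  rinvs α (List.ofFn fun i => (h i : G)) (φ fun i => (h i : G)) x

/-- The same map as `piC` for a central element `x`, in which case `C_G(x) = G`:
`π^n_{G,x,α} : C^n(k_αG, k_αG) → C^n(G, k x̄)`. -/
def piZ (α : G → G → kˣ) (x : G) {n : ℕ} (φ : (Fin n → G) → (G → k)) :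
    (Fin n → G) → k := fun h =>
  rinvs α (List.ofFn h) (φ h) x

/-- The map `ν^n_{G,x,α} : C^n(G, k x̄) → C^n(k_αG, k_αG)` for `x ∈ Z(G)`:
`ψ ↦ (ḡ₁⊗…⊗ḡₙ ↦ ψ(g₁,…,gₙ)·x̄·ḡ₁·…·ḡₙ)` (identifying `k x̄` with `k`). -/
def nuZ (α : G → G → kˣ) (x : G) {n : ℕ} (ψ : (Fin n → G) → k) :
    (Fin n → G) → (G → k) := fun g =>
  ψ g • rmuls α (List.ofFn g) (Pi.single x 1)

/-- Iteration of the index map of a coset decomposition along a list of group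
elements: `chainIdx idx j [g₁,…,gᵢ]` is the index `s_j^i`. -/
def chainIdx {m : ℕ} (idx : Fin m → G → Fin m) (j : Fin m) : List G → Fin m
  | [] => j
  | a :: l => chainIdx idx (idx j a) l

/-- The map `ν^n_{G,x} : C^n(C_G(x), kx) → C^n(kG, kG)` for the (untwisted) group
algebra, relative to a right coset decomposition `G = ⋃ⱼ C_G(x)γⱼ`:
`ν(ψ)(g₁⊗…⊗gₙ) = Σⱼ ψ(h_{j,1},…,h_{j,n})·x⁻¹·xⱼ·g₁⋯gₙ` where
`xⱼ = γⱼ⁻¹xγⱼ`, the `h_{j,i} = rep (s_j^{i-1}) gᵢ ∈ C_G(x)` are determined by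
`γ_{s_j^{i-1}}·gᵢ = h_{j,i}·γ_{s_j^i}` and `kx` is identified with `k`. -/
def nuT (x : G) {m n : ℕ} (γ : Fin m → G) (idx : Fin m → G → Fin m)
    (rep : Fin m → G → G)
    (hrep : ∀ j a, rep j a ∈ Subgroup.centralizer ({x} : Set G))
    (ψ : (Fin n → Subgroup.centralizer ({x} : Set G)) → k) :
    (Fin n → G) → (G → k) := fun g =>
  ∑ j : Fin m,
    ψ (fun i => ⟨rep (chainIdx idx j ((List.ofFn g).take (i : ℕ))) (g i), hrep _ _⟩) •
      (Pi.single ((γ j)⁻¹ * x * γ j * (List.ofFn g).prod) (1 : k) : G → k)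

/-- `φ` is a Hochschild coboundary (for `n = 0` the coboundary space is `0`). -/
def IsHCoboundary (α : G → G → kˣ) (L R : G → M →ₗ[k] M) :
    ∀ {n : ℕ}, ((Fin n → G) → M) → Prop
  | 0, φ => φ = 0
  | _ + 1, φ => ∃ θ, φ = hDiff α L R θ

/-- `φ` is the Hochschild coboundary of a `Σ`-invariant cochain. -/
def IsHSCoboundary (α : G → G → kˣ) (L R : G → M →ₗ[k] M) :
    ∀ {n : ℕ}, ((Fin n → G) → M) → Prop
  | 0, φ => φ = 0
  | _ + 1, φ => ∃ θ, (∀ i0, hSigma α L R i0 θ = θ) ∧ φ = hDiff α L R θ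

/-- `ψ` is a group-cohomology coboundary (coefficients in `k` through `χ`). -/
def IsCCoboundary (χ : H → k) : ∀ {n : ℕ}, ((Fin n → H) → k) → Prop
  | 0, ψ => ψ = 0
  | _ + 1, ψ => ∃ θ, ψ = cDiff χ θ

/-- `ψ` is the coboundary of a `Σ`-invariant group cochain (coefficients through `χ`). -/
def IsCSCoboundary (χ : H → k) : ∀ {n : ℕ}, ((Fin n → H) → k) → Prop
  | 0, ψ => ψ = 0
  | _ + 1, ψ => ∃ θ, (∀ i0, cSigma χ i0 θ = θ) ∧ ψ = cDiff χ θ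

/-- `ψ` is a group-cohomology coboundary (coefficients in the `H`-module `A`). -/
def IsGCoboundary : ∀ {n : ℕ}, ((Fin n → H) → A) → Prop
  | 0, ψ => ψ = 0
  | _ + 1, ψ => ∃ θ, ψ = gDiff θ

/-- `ψ` is the coboundary of a `Σ`-invariant group cochain (coefficients in `A`). -/
def IsGSCoboundary : ∀ {n : ℕ}, ((Fin n → H) → A) → Prop
  | 0, ψ => ψ = 0
  | _ + 1, ψ => ∃ θ, (∀ i0, gSigma i0 θ = θ) ∧ ψ = gDiff θ

end Defs

section BasisMultiplication

variable {k : Type*} [CommRing k] {G : Type*} [Group G]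

theorem Rmul_one {α : G → G → kˣ} (hnorm : IsNormalized α) (v : G → k) : Rmul α 1 v = v := by
  funext y
  simp [Rmul, (hnorm y).2]

theorem Rmul_Rmul {α : G → G → kˣ} (hα : IsCocycle α) (g h : G) (v : G → k) :
    Rmul α h (Rmul α g v) = (α g h : k) • Rmul α (g * h) v := by
  funext y
  have hy := congrArg (Units.val) (hα (y * h⁻¹ * g⁻¹) g h)
  simp only [inv_mul_cancel_right, Units.val_mul] at hy
  simp only [Rmul, LinearMap.coe_mk, AddHom.coe_mk, Pi.smul_apply, smul_eq_mul, mul_inv_rev,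
    ← mul_assoc]
  rw [← hy]
  ring

theorem Lmul_Rmul {α : G → G → kˣ} (hα : IsCocycle α) (g h : G) (v : G → k) :
    Lmul α g (Rmul α h v) = Rmul α h (Lmul α g v) := by
  funext y
  have hy := congrArg (Units.val) (hα g (g⁻¹ * (y * h⁻¹)) h)
  simp only [mul_assoc, inv_mul_cancel, mul_one, mul_inv_cancel_left, Units.val_mul] at hy
  simp only [Rmul, Lmul, LinearMap.coe_mk, AddHom.coe_mk, mul_assoc]
  rw [← mul_assoc, hy, mul_assoc]

theorem Lmul_single [DecidableEq G] (α : G → G → kˣ) {x : G} (hx : x ∈ Subgroup.center G)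
    (g : G) :
    Lmul α g (Pi.single x 1) = (chi α x g : k) • Rmul α g (Pi.single x 1) := by
  have hc := Subgroup.mem_center_iff.mp hx g
  funext y
  by_cases hy : y = g * x
  · subst hy
    have h1 : g⁻¹ * (g * x) = x := inv_mul_cancel_left g x
    have h2 : g * x * g⁻¹ = x := by rw [hc, mul_inv_cancel_right]
    simp [Lmul, Rmul, chi, h1, h2]
  · have h1 : g⁻¹ * y ≠ x := fun h => hy (inv_mul_eq_iff_eq_mul.mp h)
    have h2 : y * g⁻¹ ≠ x := fun h => hy (by rw [hc]; exact mul_inv_eq_iff_eq_mul.mp h)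
    simp [Lmul, Rmul, h1, h2]

theorem inv_smul_Rmul_inv_Rmul {α : G → G → kˣ} (hα : IsCocycle α) (hnorm : IsNormalized α)
    (g : G) (v : G → k) :
    (((α g g⁻¹)⁻¹ : kˣ) : k) • Rmul α g⁻¹ (Rmul α g v) = v := by
  rw [Rmul_Rmul hα, mul_inv_cancel, Rmul_one hnorm, smul_smul, Units.inv_mul, one_smul]

theorem rmuls_cons (α : G → G → kˣ) (g : G) (l : List G) (v : G → k) :
    rmuls α (g :: l) v = rmuls α l (Rmul α g v) := rfl

theorem rmuls_smul (α : G → G → kˣ) (c : k) (l : List G) (v : G → k) :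
    rmuls α l (c • v) = c • rmuls α l v := by
  induction l generalizing v with
  | nil => rfl
  | cons g l ih => rw [rmuls_cons, rmuls_cons, map_smul, ih]

theorem Lmul_rmuls {α : G → G → kˣ} (hα : IsCocycle α) (g : G) (l : List G) (v : G → k) :
    Lmul α g (rmuls α l v) = rmuls α l (Lmul α g v) := by
  induction l generalizing v with
  | nil => rfl
  | cons h l ih => rw [rmuls_cons, rmuls_cons, ih, Lmul_Rmul hα]

end BasisMultiplication

section SwapTuple

variable {H : Type*} [Group H]

theorem swapTuple_zero_zero {n : ℕ} (g : Fin (n + 1) → H) : swapTuple 0 g 0 = (g 0)⁻¹ := by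
  simp [swapTuple]

theorem tail_swapTuple_zero {n : ℕ} (g : Fin (n + 2) → H) :
    Fin.tail (swapTuple 0 g) = Fin.cons (g 0 * g 1) (Fin.tail (Fin.tail g)) := by
  funext j
  refine Fin.cases ?_ (fun j => ?_) j
  · simp [swapTuple, Fin.tail]
  · simp [swapTuple, Fin.tail, Fin.ext_iff]

theorem swapTuple_one_zero {n : ℕ} (g : Fin (n + 2) → H) :
    swapTuple (Fin.succ 0) g 0 = g 0 * g 1 := by
  simp [swapTuple]

theorem swapTuple_succ_succ_zero {n : ℕ} (i : Fin n) (g : Fin (n + 2) → H) :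
    swapTuple i.succ.succ g 0 = g 0 := by
  simp [swapTuple, Fin.ext_iff]

theorem tail_swapTuple_succ {n : ℕ} (i : Fin n) (g : Fin (n + 1) → H) :
    Fin.tail (swapTuple i.succ g) = swapTuple i (Fin.tail g) := by
  funext j
  simp [swapTuple, Fin.tail, Fin.ext_iff]

end SwapTuple

section RightFactor

variable {k : Type*} [CommRing k] {G : Type*} [Group G]

/-- The part of the action of `σ_{i+1}` that comes from the entries at positions `i` and `i + 1`
of the tuple: the scalars of `ḡ_i⁻¹` and of `ḡ_i·ḡ_{i+1}`, the latter replaced by the right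
multiplication by `ḡ_i` if `i` is the last position. -/
def rightFactor (α : G → G → kˣ) {n : ℕ} (i : Fin n) (g : Fin n → G) (w : G → k) : G → k :=
  ((((α (g i) (g i)⁻¹)⁻¹ : kˣ) : k) *
      (if h : (i : ℕ) + 1 < n then (α (g i) (g ⟨(i : ℕ) + 1, h⟩) : k) else 1)) •
    (if (i : ℕ) + 1 = n then Rmul α (g i) w else w)

theorem rightFactor_smul (α : G → G → kˣ) {n : ℕ} (i : Fin n) (g : Fin n → G) (c : k)
    (w : G → k) : rightFactor α i g (c • w) = c • rightFactor α i g w := by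
  unfold rightFactor
  split_ifs <;> first | rw [map_smul, smul_comm] | rw [smul_comm]

theorem rightFactor_succ (α : G → G → kˣ) {n : ℕ} (i : Fin n) (g : Fin (n + 1) → G)
    (w : G → k) : rightFactor α i.succ g w = rightFactor α i (Fin.tail g) w := by
  simp [rightFactor, Fin.tail]

theorem rmuls_ofFn_succ (α : G → G → kˣ) {n : ℕ} (g : Fin (n + 1) → G) (v : G → k) :
    rmuls α (List.ofFn g) v = rmuls α (List.ofFn (Fin.tail g)) (Rmul α (g 0) v) := by
  rw [List.ofFn_succ]
  rfl

theorem rightFactor_zero_rmuls {α : G → G → kˣ} (hα : IsCocycle α) (hnorm : IsNormalized α)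
    {n : ℕ} (g : Fin (n + 1) → G) (v : G → k) :
    rightFactor α 0 g (rmuls α (List.ofFn (swapTuple 0 g)) (Rmul α (g 0) v)) =
      rmuls α (List.ofFn g) v := by
  cases n with
  | zero =>
    rw [rmuls_ofFn_succ, rmuls_ofFn_succ α g, swapTuple_zero_zero]
    simp only [List.ofFn_zero, rmuls, List.foldl_nil]
    simp only [rightFactor, Fin.val_zero, zero_add, lt_irrefl, dite_false, if_true, mul_one]
    rw [← map_smul, inv_smul_Rmul_inv_Rmul hα hnorm]
  | succ n =>
    have htail : Fin.tail g 0 = g 1 := rfl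
    rw [rmuls_ofFn_succ, swapTuple_zero_zero, rmuls_ofFn_succ, tail_swapTuple_zero, Fin.cons_zero,
      Fin.tail_cons, rmuls_ofFn_succ α g, rmuls_ofFn_succ α (Fin.tail g), htail]
    have hlt : ((0 : Fin (n + 1 + 1)) : ℕ) + 1 < n + 1 + 1 := by simp
    rw [rightFactor, dif_pos hlt, if_neg hlt.ne, mul_comm, mul_smul, ← rmuls_smul, ← map_smul,
      inv_smul_Rmul_inv_Rmul hα hnorm, ← rmuls_smul]
    exact congrArg (rmuls α _) (Rmul_Rmul hα (g 0) (g 1) v).symm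

theorem rightFactor_succ_rmuls {α : G → G → kˣ} (hα : IsCocycle α) (hnorm : IsNormalized α)
    {n : ℕ} (i : Fin n) (g : Fin (n + 1) → G) (v : G → k) :
    (α (g i.castSucc) (g i.succ) : k) •
        rightFactor α i.succ g (rmuls α (List.ofFn (swapTuple i.succ g)) v) =
      rmuls α (List.ofFn g) v := by
  induction n generalizing v with
  | zero => exact i.elim0
  | succ n ih =>
    rw [rmuls_ofFn_succ, rmuls_ofFn_succ α g, rightFactor_succ, tail_swapTuple_succ]
    refine Fin.cases ?_ (fun j => ?_) i
    · rw [swapTuple_one_zero, ← rightFactor_smul, ← rmuls_smul,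
        ← rightFactor_zero_rmuls hα hnorm (Fin.tail g)]
      exact congrArg (fun w => rightFactor α 0 _ (rmuls α _ w)) (Rmul_Rmul hα (g 0) (g 1) v).symm
    · rw [swapTuple_succ_succ_zero]
      exact ih j (Fin.tail g) _

end RightFactor

/-- for `x ∈ Z(G)`, `ν^n_{G,x,α}` is `Σ_{n+1}`-equivariant: it
intertwines Staic's action on `C^n(G, k x̄)` with the symmetric Hochschild action
on `C^n(k_αG,k_αG)` (it suffices to check this on the transpositions `σ_i`). -/
theorem nuZ_equivariant
    {k : Type*} [Field k] {G : Type*} [Group G] [Fintype G] [DecidableEq G]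
    (α : G → G → kˣ) (hα : IsCocycle α) (hnorm : IsNormalized α)
    (x : G) (hx : x ∈ Subgroup.center G)
    {n : ℕ} (ψ : (Fin n → G) → k) (i0 : Fin n) :
    nuZ α x (cSigma (chi α x) i0 ψ) =
      hSigma α (Lmul α) (Rmul α) i0 (nuZ α x ψ) := by
  funext g
  cases n with
  | zero => exact i0.elim0
  | succ n =>
    refine Fin.cases ?_ (fun i => ?_) i0
    · have hsigma : hSigma α (Lmul α) (Rmul α) 0 (nuZ α x ψ) g =
          -rightFactor α 0 g (Lmul α (g 0) (nuZ α x ψ (swapTuple 0 g))) := by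
        have hzero : ((0 : Fin (n + 1)) : ℕ) = 0 := rfl
        rw [hSigma, rightFactor, if_neg hzero.not_gt, if_pos hzero, one_mul,
          apply_ite (Lmul α (g 0)), Lmul_Rmul hα]
      rw [hsigma]
      simp only [nuZ, cSigma, Fin.val_zero, if_true]
      rw [map_smul, Lmul_rmuls hα, Lmul_single α hx, rmuls_smul, rightFactor_smul,
        rightFactor_smul, rightFactor_zero_rmuls hα hnorm, smul_smul, neg_smul, mul_comm]
    · have hsigma : hSigma α (Lmul α) (Rmul α) i.succ (nuZ α x ψ) g =
          -((α (g i.castSucc) (g i.succ) : k) •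
            rightFactor α i.succ g (nuZ α x ψ (swapTuple i.succ g))) := by
        have hpos : 0 < (i.succ : ℕ) := by simp
        simp only [hSigma, rightFactor, if_pos hpos, if_neg hpos.ne', smul_smul, mul_assoc]
        rfl
      rw [hsigma]
      simp only [nuZ, cSigma, Fin.val_succ, Nat.succ_ne_zero, if_false]
      rw [rightFactor_smul, smul_comm, rightFactor_succ_rmuls hα hnorm, neg_smul]

end TwistedSym
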